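/- If S ⊆ α ∩ cof(ω) for an ordinal α of uncountable cofinality, then S is stationary in α if and only if the set {a ∈ [α]^ω : sup(a) ∈ S} is stationary in [α]^ω. -/

import Mathlib

open Set

/-- `C` is a club subset of the ordinal `α`. -/
def ClubIn (α : Ordinal) (C : Set Ordinal) : Prop :=
  C ⊆ Set.Iio α ∧ (∀ ξ < α, ∃ β ∈ C, ξ < β) ∧
    ∀ x, x ⊆ C → x.Nonempty → sSup x < α → sSup x ∈ C

/-- `S` is stationary in the ordinal `α`. -/
def StatIn (α : Ordinal) (S : Set Ordinal) : Prop :=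
  ∀ C, ClubIn α C → (S ∩ C).Nonempty

/-- `T` is a club subset of `[α]^ω`: a collection of countable subsets of `α`
that is cofinal and closed under unions of increasing `ω`-chains. -/
def ClubSub (α : Ordinal) (T : Set (Set Ordinal)) : Prop :=
  (∀ a ∈ T, a ⊆ Set.Iio α ∧ a.Countable) ∧
  (∀ a : Set Ordinal, a ⊆ Set.Iio α → a.Countable → ∃ b ∈ T, a ⊆ b) ∧
  (∀ c : ℕ → Set Ordinal, (∀ n, c n ∈ T) → (∀ n, c n ⊆ c (n + 1)) →
    (⋃ n, c n) ∈ T)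

/-- `T'` is stationary in `[α]^ω`. -/
def StatSub (α : Ordinal) (T' : Set (Set Ordinal)) : Prop :=
  ∀ T, ClubSub α T → (T' ∩ T).Nonempty


universe w

theorem aux_countable_sup {α : Ordinal.{w}} (hcf : Cardinal.aleph0 < α.cof) {a : Set Ordinal.{w}}
    (ha : a ⊆ Set.Iio α) (hc : a.Countable) : sSup a < α := by
  apply Ordinal.sSup_lt_of_lt_cof _ (fun i hi => ha hi)
  rw [← Ordinal.lift_cof]
  refine (Cardinal.le_aleph0_iff_set_countable.2 hc).trans_lt ?_
  rw [← Cardinal.lift_aleph0.{w+1, w}]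
  exact Cardinal.lift_lt.2 hcf

theorem aux_bdd {α : Ordinal.{w}} {a : Set Ordinal.{w}}
    (ha : a ⊆ Set.Iio α) : BddAbove a := ⟨α, fun _ h => (ha h).le⟩

theorem aux_succ {α : Ordinal.{w}} (hcf : Cardinal.aleph0 < α.cof) {ξ : Ordinal.{w}} (h : ξ < α) :
    Order.succ ξ < α :=
  (Ordinal.aleph0_le_cof.1 hcf.le).succ_lt h

theorem aux_backward (α : Ordinal.{w}) (hcf : Cardinal.aleph0 < α.cof) (S : Set Ordinal.{w})
    (h : StatSub α {a | a ⊆ Set.Iio α ∧ a.Countable ∧ sSup a ∈ S}) : StatIn α S := by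
  intro C ⟨hC1, hC2, hC3⟩
  obtain ⟨a, ⟨_, _, haS⟩, _, _, haC⟩ := h {a | a ⊆ Set.Iio α ∧ a.Countable ∧ sSup a ∈ C} (by
    refine ⟨fun a ha => ⟨ha.1, ha.2.1⟩, ?_, ?_⟩
    · intro a ha hc
      obtain ⟨β, hβ, hlt⟩ := hC2 _ (aux_countable_sup hcf ha hc)
      refine ⟨insert β a, ⟨?_, hc.insert _, ?_⟩, subset_insert _ _⟩
      · exact insert_subset (hC1 hβ) ha
      · have : IsGreatest (insert β a) β := by
          refine ⟨mem_insert _ _, ?_⟩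
          rintro x (rfl | hx)
          · exact le_rfl
          · exact (le_csSup (aux_bdd ha) hx).trans hlt.le
        rw [this.csSup_eq]; exact hβ
    · intro c hc _
      have hsub : (⋃ n, c n) ⊆ Iio α := iUnion_subset fun n => (hc n).1
      have hcount : (⋃ n, c n).Countable := countable_iUnion fun n => (hc n).2.1
      have hr : range (fun n => sSup (c n)) ⊆ C := by
        rintro _ ⟨n, rfl⟩; exact (hc n).2.2
      have heq : sSup (⋃ n, c n) = sSup (range (fun n => sSup (c n))) := by
        apply le_antisymm
        · apply csSup_le'
          intro x hx
          obtain ⟨n, hn⟩ := mem_iUnion.1 hx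
          exact (le_csSup (aux_bdd (hc n).1) hn).trans
            (le_csSup (aux_bdd (hr.trans hC1)) ⟨n, rfl⟩)
        · apply csSup_le'
          rintro _ ⟨n, rfl⟩
          apply csSup_le'
          intro x hx
          exact le_csSup (aux_bdd hsub) (mem_iUnion.2 ⟨n, hx⟩)
      refine ⟨hsub, hcount, ?_⟩
      have := aux_countable_sup hcf hsub hcount
      rw [heq] at this ⊢
      exact hC3 _ hr (range_nonempty _) this)
  exact ⟨_, haS, haC⟩

/-- A cofinal set all of whose proper initial segments have size below the cofinality. -/
theorem aux_D (α : Ordinal.{w}) (hcf : Cardinal.aleph0 < α.cof) :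
    ∃ D : Set Ordinal.{w}, D ⊆ Iio α ∧ (∀ ξ < α, ∃ d ∈ D, ξ < d) ∧
      ∀ ξ < α, Cardinal.mk (D ∩ Iio ξ : Set Ordinal.{w}) < (Ordinal.lift.{w+1} α).cof := by
  obtain ⟨e, he⟩ := Ordinal.exists_isFundamentalSeq (o := α) rfl
  refine ⟨range (fun i => (e i).1), ?_, ?_, ?_⟩
  · rintro _ ⟨i, rfl⟩; exact (e i).2
  · intro ξ hξ
    obtain ⟨_, ⟨i, rfl⟩, hi⟩ := he.isCofinal_range ⟨_, aux_succ hcf hξ⟩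
    exact ⟨_, ⟨i, rfl⟩, (Order.lt_succ ξ).trans_le hi⟩
  · intro ξ hξ
    obtain ⟨_, ⟨j, rfl⟩, hj⟩ := he.isCofinal_range ⟨ξ, hξ⟩
    have hsub : (range (fun i => (e i).1) ∩ Iio ξ : Set Ordinal.{w}) ⊆
        range (fun i : Iio j.1 => (e ⟨i.1, mem_Iio.2 (lt_trans (mem_Iio.1 i.2) (mem_Iio.1 j.2))⟩).1) := by
      rintro _ ⟨⟨i, rfl⟩, hi⟩
      have : e i < e j := lt_of_lt_of_le (show e i < ⟨ξ, hξ⟩ from hi) hj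
      exact ⟨⟨i.1, he.strictMono.lt_iff_lt.1 this⟩, rfl⟩
    refine (Cardinal.mk_le_mk_of_subset hsub).trans_lt (Cardinal.mk_range_le.trans_lt ?_)
    rw [Cardinal.mk_Iio_ordinal, ← Ordinal.lift_cof, Cardinal.lift_lt]
    exact Cardinal.lt_ord.1 j.2

theorem aux_forward (α : Ordinal.{w}) (hcf : Cardinal.aleph0 < α.cof) (S : Set Ordinal.{w})
    (hS : ∀ β ∈ S, β < α ∧ β.cof = Cardinal.aleph0) (h : StatIn α S) :
    StatSub α {a | a ⊆ Set.Iio α ∧ a.Countable ∧ sSup a ∈ S} := by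
  intro T ⟨hT1, hT2, hT3⟩
  obtain ⟨D, hD1, hD2, hD3⟩ := aux_D α hcf
  choose! G hG1 hG2 using hT2
  let F : List Ordinal.{w} → Set Ordinal.{w} := fun l => l.foldr (fun d X => G (insert d X)) (G ∅)
  have hFT : ∀ l : List Ordinal.{w}, (∀ d ∈ l, d < α) → F l ∈ T := by
    intro l
    induction l with
    | nil => intro _; exact hG1 _ (empty_subset _) countable_empty
    | cons d l ih =>
      intro hl
      have := hT1 _ (ih fun x hx => hl x (List.mem_cons_of_mem _ hx))
      exact hG1 _ (insert_subset (hl d List.mem_cons_self) this.1) (this.2.insert _)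
  have hFs : ∀ (l : List Ordinal.{w}) (d), (∀ x ∈ d :: l, x < α) →
      insert d (F l) ⊆ F (d :: l) := by
    intro l d hl
    have := hT1 _ (hFT l fun x hx => hl x (List.mem_cons_of_mem _ hx))
    exact hG2 _ (insert_subset (hl d List.mem_cons_self) this.1) (this.2.insert _)
  let C : Set Ordinal.{w} := {β | β < α ∧ (∀ δ < β, ∃ d ∈ D, δ < d ∧ d < β) ∧
    ∀ l : List Ordinal.{w}, (∀ d ∈ l, d ∈ D ∧ d < β) → F l ⊆ Iio β}
  -- one step of the closure process
  have step : ∀ ξ < α, ∃ η < α, (∃ d ∈ D, ξ < d ∧ d < η) ∧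
      ∀ l : List Ordinal.{w}, (∀ d ∈ l, d ∈ D ∧ d < ξ) → F l ⊆ Iio η := by
    intro ξ hξ
    let R : Set Ordinal.{w} :=
      range (fun l : List (D ∩ Iio ξ : Set Ordinal.{w}) => sSup (F (l.map Subtype.val)))
    have hlt : ∀ l : List (D ∩ Iio ξ : Set Ordinal.{w}), ∀ d ∈ l.map Subtype.val, d < α := by
      intro l d hd
      obtain ⟨x, _, rfl⟩ := List.mem_map.1 hd
      exact hD1 x.2.1
    have hR : R ⊆ Iio α := by
      rintro _ ⟨l, rfl⟩
      have := hT1 _ (hFT _ (hlt l))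
      exact aux_countable_sup hcf this.1 this.2
    have hRs : sSup R < α := by
      apply Ordinal.sSup_lt_of_lt_cof _ (fun i hi => hR hi)
      refine Cardinal.mk_range_le.trans_lt ((Cardinal.mk_list_le_max _).trans_lt ?_)
      refine max_lt ?_ (hD3 ξ hξ)
      rw [← Ordinal.lift_cof, ← Cardinal.lift_aleph0.{w+1, w}]
      exact Cardinal.lift_lt.2 hcf
    obtain ⟨d, hd, hξd⟩ := hD2 ξ hξ
    refine ⟨Order.succ (max d (sSup R)), aux_succ hcf (max_lt (hD1 hd) hRs),
      ⟨d, hd, hξd, Order.lt_succ_of_le (le_max_left _ _)⟩, ?_⟩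
    intro l hl x hx
    let l' : List (D ∩ Iio ξ : Set Ordinal.{w}) := l.attach.map (fun y => ⟨y.1, hl y.1 y.2⟩)
    have hl' : l'.map Subtype.val = l := by simp [l']
    have hb := aux_bdd (hT1 _ (hFT _ (hlt l'))).1
    have h1 : x ≤ sSup (F (l'.map Subtype.val)) := le_csSup hb (by rw [hl']; exact hx)
    exact Order.lt_succ_of_le ((h1.trans (le_csSup (aux_bdd hR) ⟨l', rfl⟩)).trans
      (le_max_right _ _))
  have listmax : ∀ (P : Ordinal.{w} → Prop), (∃ y, P y) → ∀ l : List Ordinal.{w},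
      (∀ d ∈ l, ∃ y, P y ∧ d < y) → ∃ y, P y ∧ ∀ d ∈ l, d < y := by
    intro P ⟨y0, hy0⟩ l
    induction l with
    | nil => intro _; exact ⟨y0, hy0, by simp⟩
    | cons d l ih =>
      intro hl
      obtain ⟨y, hy, hyl⟩ := ih fun x hx => hl x (List.mem_cons_of_mem _ hx)
      obtain ⟨z, hz, hdz⟩ := hl d List.mem_cons_self
      rcases le_total y z with hyz | hyz
      · refine ⟨z, hz, ?_⟩
        intro x hx
        rcases List.mem_cons.1 hx with rfl | hx
        · exact hdz
        · exact (hyl x hx).trans_le hyz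
      · refine ⟨y, hy, ?_⟩
        intro x hx
        rcases List.mem_cons.1 hx with rfl | hx
        · exact hdz.trans_le hyz
        · exact hyl x hx
  have hC : ClubIn α C := by
    refine ⟨fun β hβ => hβ.1, ?_, ?_⟩
    · intro ξ hξ
      choose! g hg1 hg2 hg3 using step
      let s : ℕ → Ordinal.{w} := fun n => g^[n] ξ
      have hs1 : ∀ n, s (n + 1) = g (s n) := fun n => Function.iterate_succ_apply' g n ξ
      have hs : ∀ n, s n < α := by
        intro n
        induction n with
        | zero => exact hξ
        | succ n ih => rw [hs1]; exact hg1 _ ih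
      have hr : range s ⊆ Iio α := by rintro _ ⟨n, rfl⟩; exact hs n
      have hβ := aux_countable_sup hcf hr (countable_range s)
      have hle : ∀ n, s n ≤ sSup (range s) := fun n => le_csSup (aux_bdd hr) ⟨n, rfl⟩
      refine ⟨sSup (range s), ⟨hβ, ?_, ?_⟩, ?_⟩
      · intro δ hδ
        obtain ⟨_, ⟨n, rfl⟩, hn⟩ := exists_lt_of_lt_csSup (range_nonempty s) hδ
        obtain ⟨d, hd, h1, h2⟩ := hg2 _ (hs n)
        rw [← hs1] at h2
        exact ⟨d, hd, hn.trans h1, h2.trans_le (hle _)⟩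
      · intro l hl
        obtain ⟨_, ⟨n, rfl⟩, hn⟩ := listmax (· ∈ range s) ⟨_, 0, rfl⟩ l (fun d hd =>
          exists_lt_of_lt_csSup (range_nonempty s) (hl d hd).2)
        have := hg3 _ (hs n) l (fun d hd => ⟨(hl d hd).1, hn d hd⟩)
        rw [← hs1] at this
        exact this.trans (Iio_subset_Iio (hle _))
      · obtain ⟨d, hd, h1, h2⟩ := hg2 _ (hs 0)
        rw [← hs1] at h2
        exact (h1.trans h2).trans_le (hle _)
    · intro x hx hne hsup
      have hb : BddAbove x := aux_bdd (α := α) (fun y hy => (hx hy).1)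
      refine ⟨hsup, ?_, ?_⟩
      · intro δ hδ
        obtain ⟨y, hy, hδy⟩ := exists_lt_of_lt_csSup hne hδ
        obtain ⟨d, hd, h1, h2⟩ := (hx hy).2.1 δ hδy
        exact ⟨d, hd, h1, h2.trans_le (le_csSup hb hy)⟩
      · intro l hl
        obtain ⟨y, hy, hyl⟩ := listmax (· ∈ x) hne l (fun d hd =>
          exists_lt_of_lt_csSup hne (hl d hd).2)
        exact ((hx hy).2.2 l fun d hd => ⟨(hl d hd).1, hyl d hd⟩).trans
          (Iio_subset_Iio (le_csSup hb hy))
  obtain ⟨β, hβS, hβα, hβD, hβF⟩ := h C hC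
  obtain ⟨f, hf⟩ := Ordinal.exists_isFundamentalSeq (o := β) (a := Ordinal.omega0)
    (by rw [(hS β hβS).2, Cardinal.ord_aleph0])
  choose! p hp1 hp2 hp3 using hβD
  let q : ℕ → Ordinal.{w} := fun n => p (f ⟨n, Ordinal.natCast_lt_omega0 n⟩).1
  have hq1 : ∀ n, q n ∈ D := fun n => hp1 _ (f _).2
  have hq3 : ∀ n, q n < β := fun n => hp3 _ (f _).2
  have hq2 : ∀ δ < β, ∃ n, δ < q n := by
    intro δ hδ
    obtain ⟨_, ⟨⟨i, hi⟩, rfl⟩, h'⟩ := hf.isCofinal_range ⟨δ, hδ⟩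
    obtain ⟨n, rfl⟩ := Ordinal.lt_omega0.1 hi
    exact ⟨n, lt_of_le_of_lt h' (hp2 _ (f _).2)⟩
  let L : ℕ → List Ordinal.{w} := fun n => Nat.rec [] (fun n l => q n :: l) n
  have hL : ∀ n, ∀ d ∈ L n, d ∈ D ∧ d < β := by
    intro n
    induction n with
    | zero => intro d hd; exact absurd hd List.not_mem_nil
    | succ n ih =>
      intro d hd
      rcases List.mem_cons.1 (show d ∈ q n :: L n from hd) with rfl | hd
      · exact ⟨hq1 n, hq3 n⟩
      · exact ih d hd
  have hLα : ∀ n, ∀ d ∈ L n, d < α := fun n d hd => hD1 (hL n d hd).1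
  have hins : ∀ n, insert (q n) (F (L n)) ⊆ F (L (n + 1)) := fun n => hFs _ _ (hLα (n + 1))
  have hmem : (⋃ n, F (L n)) ∈ T :=
    hT3 _ (fun n => hFT _ (hLα n)) (fun n => (subset_insert _ _).trans (hins n))
  have hsubβ : (⋃ n, F (L n)) ⊆ Iio β := iUnion_subset fun n => hβF _ (hL n)
  have hsup : sSup (⋃ n, F (L n)) = β := by
    apply le_antisymm
    · exact csSup_le' fun x hx => (hsubβ hx).le
    · by_contra hlt
      obtain ⟨n, hn⟩ := hq2 _ (not_le.1 hlt)
      exact absurd (le_csSup (aux_bdd hsubβ)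
        (mem_iUnion.2 ⟨n + 1, hins n (mem_insert _ _)⟩)) (not_le.2 hn)
  exact ⟨_, ⟨(hT1 _ hmem).1, (hT1 _ hmem).2, by rw [hsup]; exact hβS⟩, hmem⟩

/-- For `S ⊆ α ∩ cof(ω)` with `α` of uncountable cofinality, `S` is stationary
in `α` iff `{a ∈ [α]^ω : sup(a) ∈ S}` is stationary in `[α]^ω`. -/
theorem stmt16 (α : Ordinal) (hcf : Cardinal.aleph0 < α.cof)
    (S : Set Ordinal) (hS : ∀ β ∈ S, β < α ∧ β.cof = Cardinal.aleph0) :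
    StatIn α S ↔
      StatSub α {a | a ⊆ Set.Iio α ∧ a.Countable ∧ sSup a ∈ S} :=
  ⟨aux_forward α hcf S hS, aux_backward α hcf S⟩
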